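/- Let n ≥ 1, k ≥ 0, N ≥ 0 be integers, let ν be a real number, set μ = (2k+n)(2k+n+2) − n² and ℓ = n + N. Then the integral ∫₀^π δV(s) [y_{ℓ,n}(s)]² ds converges and equals −ν²/((2n+2N−1)(2n+2N+3)) · [ 4N⁴ + (16n+8)N³ + (−6k² − 6k(n+1) + 20n² + 21n + 1)N² + (2n+1)(−6k² − 6k(n+1) + 4n² + 5n − 3)N − (2n−1)(2k²(n+2) + 2k(n²+3n+2) − n(n+1)) ]. -/

import Mathlib

open Set Real

/-- The Legendre polynomial `P_ℓ(x) = (1/(2^ℓ ℓ!)) (d/dx)^ℓ (x²−1)^ℓ`. -/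
noncomputable def legendreP (l : ℕ) (x : ℝ) : ℝ :=
  (1 / ((2 : ℝ) ^ l * (Nat.factorial l : ℝ))) * iteratedDeriv l (fun t => (t ^ 2 - 1) ^ l) x

/-- The associated Legendre function `P_ℓⁿ(x) = (1−x²)^{n/2} (d/dx)ⁿ P_ℓ(x)` for `0 ≤ n ≤ ℓ`. -/
noncomputable def assocLegendreP (l n : ℕ) (x : ℝ) : ℝ :=
  (1 - x ^ 2) ^ ((n : ℝ) / 2) * iteratedDeriv n (legendreP l) x

/-- The normalized eigenfunction
`y_{ℓ,n}(s) = √((1+2ℓ)(ℓ−n)!/(2(ℓ+n)!)) · √(sin s) · P_ℓⁿ(cos s)`. -/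
noncomputable def pageY (l n : ℕ) (s : ℝ) : ℝ :=
  Real.sqrt ((1 + 2 * (l : ℝ)) * (Nat.factorial (l - n) : ℝ) / (2 * (Nat.factorial (l + n) : ℝ))) *
    (Real.sqrt (Real.sin s) * assocLegendreP l n (Real.cos s))

/-- The first-order perturbation potential
`δV(s) = (ν² csc²(s)/32)·[5μ − 4(μ + 4n² + 1)cos(2s) + 32n² s cot(s) − 16n² − μ cos(4s)
− 8 s cot(s) + 12]`. -/
noncomputable def deltaV (n : ℕ) (ν μ : ℝ) (s : ℝ) : ℝ :=
  (ν ^ 2 * (1 / Real.sin s) ^ 2 / 32) *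
    (5 * μ - 4 * (μ + 4 * (n : ℝ) ^ 2 + 1) * Real.cos (2 * s) +
      32 * (n : ℝ) ^ 2 * s * (Real.cos s / Real.sin s) - 16 * (n : ℝ) ^ 2 -
      μ * Real.cos (4 * s) - 8 * s * (Real.cos s / Real.sin s) + 12)

open Polynomial in
/-- The polynomial `D^j (X²-1)^l`. -/
noncomputable def rodr (l j : ℕ) : Polynomial ℝ := derivative^[j] ((X ^ 2 - 1) ^ l)

open Polynomial in
lemma rodr_succ (l j : ℕ) : rodr l (j + 1) = derivative (rodr l j) := by
  simp only [rodr, Function.iterate_succ_apply']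

open Polynomial in
lemma rodr_ode (l j : ℕ) :
    (X ^ 2 - 1) * rodr l (j + 2) + C (2 * ((j : ℝ) + 1) - 2 * l) * X * rodr l (j + 1)
      + C (((j : ℝ) + 1) * j - 2 * l * (j + 1)) * rodr l j = 0 := by
  induction j with
  | zero =>
    have h0 : (X ^ 2 - 1) * rodr l 1 = C (2 * (l : ℝ)) * X * rodr l 0 := by
      simp only [rodr, Function.iterate_succ_apply', Function.iterate_zero, id]
      cases l with
      | zero => simp
      | succ l =>
        rw [derivative_pow]
        simp [show (C 2 : Polynomial ℝ) = 2 from rfl]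
        ring
    have h1 := congrArg derivative h0
    rw [rodr_succ] at h1
    rw [rodr_succ, rodr_succ]
    simp only [derivative_mul, derivative_sub, derivative_X_pow, derivative_one, derivative_C,
      derivative_X] at h1
    simp [show (C 2 : Polynomial ℝ) = 2 from rfl] at h1 ⊢
    linear_combination h1
  | succ j ih =>
    have h1 := congrArg derivative ih
    simp only [derivative_mul, derivative_sub, derivative_X_pow, derivative_one, derivative_C,
      derivative_X, derivative_add, ← rodr_succ, derivative_zero] at h1
    simp [show (C 2 : Polynomial ℝ) = 2 from rfl] at h1 ⊢
    linear_combination h1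

lemma rodr_ode_eval (l n : ℕ) (x : ℝ) :
    (x ^ 2 - 1) * (rodr l (l + n + 2)).eval x + 2 * ((n : ℝ) + 1) * x * (rodr l (l + n + 1)).eval x
      + ((l : ℝ) + n + 1) * (n - l) * (rodr l (l + n)).eval x = 0 := by
  have h := congrArg (Polynomial.eval x) (rodr_ode l (l + n))
  simp at h
  linear_combination h

lemma rodr_top (l : ℕ) (x : ℝ) : (rodr l (l + l)).eval x = (Nat.factorial (2 * l) : ℝ) := by
  have hm : (Polynomial.X ^ 2 - 1 : Polynomial ℝ).Monic := by
    have := Polynomial.monic_X_pow_sub_C (1 : ℝ) (n := 2) (by norm_num)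
    simpa using this
  have hd : (Polynomial.X ^ 2 - 1 : Polynomial ℝ).natDegree = 2 := by
    have := Polynomial.natDegree_X_pow_sub_C (n := 2) (r := (1 : ℝ))
    simpa using this
  have hd2 : ((Polynomial.X ^ 2 - 1 : Polynomial ℝ) ^ l).natDegree = l + l := by
    rw [hm.natDegree_pow, hd]; ring
  have h0 : (rodr l (l + l)).natDegree = 0 := by
    have := Polynomial.natDegree_iterate_derivative ((Polynomial.X ^ 2 - 1 : Polynomial ℝ) ^ l) (l + l)
    rw [hd2] at this
    unfold rodr
    omega
  rw [Polynomial.eq_C_of_natDegree_eq_zero h0]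
  simp only [Polynomial.eval_C, rodr]
  rw [Polynomial.coeff_iterate_derivative]
  have h1 : ((Polynomial.X ^ 2 - 1 : Polynomial ℝ) ^ l).coeff (0 + (l + l)) = 1 := by
    have := (hm.pow l).coeff_natDegree
    rwa [hd2, ← zero_add (l + l)] at this
  rw [h1]
  simp [Nat.descFactorial_self, two_mul]

lemma iteratedDeriv_poly (p : Polynomial ℝ) (j : ℕ) :
    iteratedDeriv j (fun t => p.eval t) = fun t => (Polynomial.derivative^[j] p).eval t := by
  induction j with
  | zero => simp
  | succ j ih =>
    rw [iteratedDeriv_succ, ih, Function.iterate_succ_apply']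
    funext t
    exact Polynomial.deriv _

lemma legendreP_eq (l : ℕ) : legendreP l = fun x =>
    (Polynomial.C (1 / ((2 : ℝ) ^ l * (Nat.factorial l : ℝ))) * rodr l l).eval x := by
  funext x
  have h : (fun t : ℝ => (t ^ 2 - 1) ^ l) =
      fun t => ((Polynomial.X ^ 2 - 1 : Polynomial ℝ) ^ l).eval t := by
    funext t; simp
  rw [legendreP, h, iteratedDeriv_poly]
  simp [rodr]

lemma iteratedDeriv_legendreP (l n : ℕ) (x : ℝ) : iteratedDeriv n (legendreP l) x =
    1 / ((2 : ℝ) ^ l * (Nat.factorial l : ℝ)) * (rodr l (l + n)).eval x := by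
  rw [legendreP_eq, iteratedDeriv_poly]
  simp only [Polynomial.iterate_derivative_C_mul, Polynomial.eval_mul, Polynomial.eval_C]
  rw [rodr, ← Function.iterate_add_apply, add_comm n l, rodr]

lemma hasDerivAt_rodr (l j : ℕ) (s : ℝ) :
    HasDerivAt (fun s => (rodr l j).eval (cos s)) (-(sin s * (rodr l (j + 1)).eval (cos s))) s := by
  have h := ((rodr l j).hasDerivAt (cos s)).comp s (Real.hasDerivAt_cos s)
  rw [rodr_succ]
  refine h.congr_deriv ?_
  ring

lemma continuous_rodr (l j : ℕ) : Continuous (fun s : ℝ => (rodr l j).eval (cos s)) :=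
  (rodr l j).continuous.comp Real.continuous_cos

/-- The squared norm integral. -/
noncomputable def nrm (l n : ℕ) : ℝ :=
  ∫ s in (0 : ℝ)..π, sin s ^ (2 * n + 1) * (rodr l (l + n)).eval (cos s) ^ 2

lemma nrm_succ (l n : ℕ) : nrm l (n + 1) = ((l : ℝ) + n + 1) * (l - n) * nrm l n := by
  have hd : ∀ s : ℝ, HasDerivAt (fun s => sin s ^ (2 * n + 2) * ((rodr l (l + n)).eval (cos s) *
      (rodr l (l + n + 1)).eval (cos s)))
      (((l : ℝ) + n + 1) * (l - n) * (sin s ^ (2 * n + 1) * (rodr l (l + n)).eval (cos s) ^ 2)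
        - sin s ^ (2 * (n + 1) + 1) * (rodr l (l + n + 1)).eval (cos s) ^ 2) s := by
    intro s
    have h := ((Real.hasDerivAt_sin s).pow (2 * n + 2)).mul
      ((hasDerivAt_rodr l (l + n) s).mul (hasDerivAt_rodr l (l + n + 1) s))
    refine h.congr_deriv ?_
    have ho := rodr_ode_eval l n (cos s)
    have hs := Real.sin_sq_add_cos_sq s
    simp only [Pi.mul_apply, Pi.pow_apply]
    rw [show 2 * n + 2 - 1 = 2 * n + 1 by omega]
    push_cast
    generalize (rodr l (l + n)).eval (cos s) = q at *
    generalize (rodr l (l + n + 1)).eval (cos s) = q1 at *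
    generalize (rodr l (l + n + 1 + 1)).eval (cos s) = q2 at *
    simp only [pow_add, pow_mul, mul_add] at *
    generalize (sin s ^ 2) ^ n = T at *
    linear_combination (T * sin s * q) * ho - T * sin s * q * q2 * hs
  have hc0 := continuous_rodr l (l + n)
  have hc1 := continuous_rodr l (l + n + 1)
  have hI := intervalIntegral.integral_eq_sub_of_hasDerivAt (a := 0) (b := π) (fun s _ => hd s)
    (Continuous.intervalIntegrable (by fun_prop) _ _)
  rw [intervalIntegral.integral_sub (Continuous.intervalIntegrable (by fun_prop) _ _)
    (Continuous.intervalIntegrable (by fun_prop) _ _), intervalIntegral.integral_const_mul] at hI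
  simp at hI
  unfold nrm
  rw [← add_assoc]
  linarith

lemma nrm_top (l : ℕ) : nrm l l * (2 * l + 1) =
    2 * (Nat.factorial (l + l) : ℝ) * ((2 : ℝ) ^ l * (Nat.factorial l : ℝ)) ^ 2 := by
  unfold nrm
  simp only [rodr_top]
  rw [intervalIntegral.integral_mul_const, integral_sin_pow_odd]
  have h : ∀ l : ℕ, (∏ i ∈ Finset.range l, (2 * (i : ℝ) + 2) / (2 * i + 3)) *
      ((Nat.factorial (2 * l) : ℝ)) * (2 * l + 1) = ((2 : ℝ) ^ l * (Nat.factorial l : ℝ)) ^ 2 := by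
    intro l
    induction l with
    | zero => simp
    | succ l ih =>
      rw [Finset.prod_range_succ, show 2 * (l + 1) = 2 * l + 1 + 1 by ring, Nat.factorial_succ,
        Nat.factorial_succ, Nat.factorial_succ l]
      have h3 : (2 * (l : ℝ) + 3) ≠ 0 := by positivity
      push_cast
      rw [show ((2 : ℝ) ^ (l + 1) * (((l : ℝ) + 1) * (Nat.factorial l : ℝ))) ^ 2 =
        4 * ((l : ℝ) + 1) ^ 2 * ((2 : ℝ) ^ l * (Nat.factorial l : ℝ)) ^ 2 by ring, ← ih]
      field_simp
      ring
  rw [← h l, ← two_mul]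
  ring

lemma nrm_eq (N : ℕ) : ∀ n : ℕ, nrm (n + N) n * (2 * ((n + N : ℕ) : ℝ) + 1) * (Nat.factorial N : ℝ) =
    2 * (Nat.factorial (n + N + n) : ℝ) *
      ((2 : ℝ) ^ (n + N) * (Nat.factorial (n + N) : ℝ)) ^ 2 := by
  induction N with
  | zero =>
    intro n
    have := nrm_top n
    simpa using this
  | succ N ih =>
    intro n
    have h := ih (n + 1)
    rw [show n + 1 + N = n + (N + 1) by ring, nrm_succ, ← add_assoc (n + (N + 1)) n 1,
      Nat.factorial_succ (n + (N + 1) + n)] at h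
    rw [Nat.factorial_succ N]
    push_cast at h ⊢
    have hp : ((n : ℝ) + (N + 1) + n + 1) ≠ 0 := by positivity
    apply mul_left_cancel₀ hp
    linear_combination h

lemma nrm_pos (n N : ℕ) : 0 < nrm (n + N) n := by
  have h := nrm_eq N n
  by_contra hc
  push Not at hc
  have h1 : 0 < 2 * (Nat.factorial (n + N + n) : ℝ) *
      ((2 : ℝ) ^ (n + N) * (Nat.factorial (n + N) : ℝ)) ^ 2 := by positivity
  rw [← h, mul_assoc] at h1
  have h2 : 0 < (2 * ((n + N : ℕ) : ℝ) + 1) * (Nat.factorial N : ℝ) := by positivity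
  nlinarith

/-- Hypervirial relation with multiplier `s`. -/
lemma virial_s (l m : ℕ) :
    (4 * ((m : ℝ) + 1) ^ 2 - 1) * (∫ s in (0 : ℝ)..π, sin s ^ (2 * m) * (s * cos s - sin s) *
      (rodr l (l + (m + 1))).eval (cos s) ^ 2) = - (2 * l + 1) ^ 2 * nrm l (m + 1) := by
  have hd : ∀ s : ℝ, HasDerivAt (fun s => sin s ^ (2 * m + 1) *
      (s * (2 * (((m : ℝ) + 3 / 2) * cos s * (rodr l (l + (m + 1))).eval (cos s)
        - sin s ^ 2 * (rodr l (l + (m + 1) + 1)).eval (cos s)) ^ 2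
        - 2 * (((m : ℝ) + 1) ^ 2 - 1 / 4 - ((l : ℝ) + 1 / 2) ^ 2 * sin s ^ 2) *
          (rodr l (l + (m + 1))).eval (cos s) ^ 2)
        - 2 * sin s * (rodr l (l + (m + 1))).eval (cos s) *
          (((m : ℝ) + 3 / 2) * cos s * (rodr l (l + (m + 1))).eval (cos s)
        - sin s ^ 2 * (rodr l (l + (m + 1) + 1)).eval (cos s))))
      ((4 * ((m : ℝ) + 1) ^ 2 - 1) * (sin s ^ (2 * m) * (s * cos s - sin s) *
        (rodr l (l + (m + 1))).eval (cos s) ^ 2) + (2 * l + 1) ^ 2 *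
        (sin s ^ (2 * (m + 1) + 1) * (rodr l (l + (m + 1))).eval (cos s) ^ 2)) s := by
    intro s
    have hS := Real.hasDerivAt_sin s
    have hC := Real.hasDerivAt_cos s
    have hq := hasDerivAt_rodr l (l + (m + 1)) s
    have hq1 := hasDerivAt_rodr l (l + (m + 1) + 1) s
    have hy := ((hC.const_mul ((m : ℝ) + 3 / 2)).mul hq).sub ((hS.pow 2).mul hq1)
    have hV := ((((hS.pow 2).const_mul (((l : ℝ) + 1 / 2) ^ 2)).const_sub
      (((m : ℝ) + 1) ^ 2 - 1 / 4)).const_mul 2).mul (hq.pow 2)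
    have h := (hS.pow (2 * m + 1)).mul
      (((hasDerivAt_id s).mul (((hy.pow 2).const_mul 2).sub hV)).sub
        (((hS.const_mul 2).mul hq).mul hy))
    refine h.congr_deriv ?_
    have ho := rodr_ode_eval l (m + 1) (cos s)
    have hs := Real.sin_sq_add_cos_sq s
    simp only [Pi.mul_apply, Pi.pow_apply, Pi.sub_apply, id]
    rw [show 2 * m + 1 - 1 = 2 * m by omega]
    push_cast at ho ⊢
    generalize (rodr l (l + (m + 1))).eval (cos s) = q at *
    generalize (rodr l (l + (m + 1) + 1)).eval (cos s) = q1 at *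
    simp only [show l + (m + 1) + 2 = l + (m + 1) + 1 + 1 from rfl] at ho
    generalize (rodr l (l + (m + 1) + 1 + 1)).eval (cos s) = q2 at *
    simp only [pow_add, pow_mul, mul_add] at *
    generalize (sin s ^ 2) ^ m = T at *
    have e2 : cos s ^ 2 = 1 - sin s ^ 2 := by linarith
    have e3 : cos s ^ 3 = cos s * (1 - sin s ^ 2) := by rw [← e2]; ring
    have e4 : cos s ^ 4 = (1 - sin s ^ 2) ^ 2 := by rw [← e2]; ring
    have ho' : sin s ^ 2 * q2 = 2 * ((m : ℝ) + 1 + 1) * cos s * q1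
        + ((l : ℝ) + (m + 1) + 1) * (m + 1 - l) * q := by
      linear_combination q2 * hs - ho
    linear_combination (norm := skip) (T * (4 * s * ((m + 3 / 2) * cos s * q - sin s ^ 2 * q1) * sin s ^ 2 - 2 * sin s ^ 3 * q)) * ho'
    ring_nf
    simp only [e2, e3, e4]
    ring
  have hc0 := continuous_rodr l (l + (m + 1))
  have hc1 := continuous_rodr l (l + (m + 1) + 1)
  have hI := intervalIntegral.integral_eq_sub_of_hasDerivAt (a := 0) (b := π) (fun s _ => hd s)
    (Continuous.intervalIntegrable (by fun_prop) _ _)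
  rw [intervalIntegral.integral_add (Continuous.intervalIntegrable (by fun_prop) _ _)
    (Continuous.intervalIntegrable (by fun_prop) _ _), intervalIntegral.integral_const_mul,
    intervalIntegral.integral_const_mul] at hI
  simp only [sin_pi, sin_zero, zero_pow (Nat.succ_ne_zero (2 * m)), zero_mul, sub_zero] at hI
  unfold nrm
  linarith

/-- Hypervirial relation with multiplier `sin s cos s`. -/
lemma virial_sc (l m : ℕ) :
    (((l : ℝ) + 1 / 2) ^ 2 - 1) * (nrm l (m + 1) - 2 * ∫ s in (0 : ℝ)..π, sin s ^ (2 * m + 5) *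
      (rodr l (l + (m + 1))).eval (cos s) ^ 2) + (((m : ℝ) + 1) ^ 2 - 1 / 4) * nrm l (m + 1) = 0 := by
  have hd : ∀ s : ℝ, HasDerivAt (fun s => sin s ^ (2 * m + 1) *
      (sin s * cos s * (2 * (((m : ℝ) + 3 / 2) * cos s * (rodr l (l + (m + 1))).eval (cos s) - sin s ^ 2 * (rodr l (l + (m + 1) + 1)).eval (cos s)) ^ 2
        - 2 * (((m : ℝ) + 1) ^ 2 - 1 / 4 - ((l : ℝ) + 1 / 2) ^ 2 * sin s ^ 2) *
          (rodr l (l + (m + 1))).eval (cos s) ^ 2)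
        - 2 * (1 - 2 * sin s ^ 2) * sin s * (rodr l (l + (m + 1))).eval (cos s) * (((m : ℝ) + 3 / 2) * cos s * (rodr l (l + (m + 1))).eval (cos s) - sin s ^ 2 * (rodr l (l + (m + 1) + 1)).eval (cos s))
        - 4 * sin s ^ 3 * cos s * (rodr l (l + (m + 1))).eval (cos s) ^ 2))
      (4 * ((((l : ℝ) + 1 / 2) ^ 2 - 1) + (((m : ℝ) + 1) ^ 2 - 1 / 4)) *
        (sin s ^ (2 * (m + 1) + 1) * (rodr l (l + (m + 1))).eval (cos s) ^ 2)
        - 8 * (((l : ℝ) + 1 / 2) ^ 2 - 1) * (sin s ^ (2 * m + 5) * (rodr l (l + (m + 1))).eval (cos s) ^ 2)) s := by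
    intro s
    have hS := Real.hasDerivAt_sin s
    have hC := Real.hasDerivAt_cos s
    have hq := hasDerivAt_rodr l (l + (m + 1)) s
    have hq1 := hasDerivAt_rodr l (l + (m + 1) + 1) s
    have hy := ((hC.const_mul ((m : ℝ) + 3 / 2)).mul hq).sub ((hS.pow 2).mul hq1)
    have hV := ((((hS.pow 2).const_mul (((l : ℝ) + 1 / 2) ^ 2)).const_sub
      (((m : ℝ) + 1) ^ 2 - 1 / 4)).const_mul 2).mul (hq.pow 2)
    have h := (hS.pow (2 * m + 1)).mul
      ((((hS.mul hC).mul (((hy.pow 2).const_mul 2).sub hV)).sub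
        ((((((hS.pow 2).const_mul 2).const_sub 1).const_mul 2).mul hS).mul hq |>.mul hy)).sub
        ((((hS.pow 3).const_mul 4).mul hC).mul (hq.pow 2)))
    refine h.congr_deriv ?_
    have ho := rodr_ode_eval l (m + 1) (cos s)
    have hs := Real.sin_sq_add_cos_sq s
    simp only [Pi.mul_apply, Pi.pow_apply, Pi.sub_apply, id]
    rw [show 2 * m + 1 - 1 = 2 * m by omega]
    push_cast at ho ⊢
    generalize (rodr l (l + (m + 1))).eval (cos s) = q at *
    generalize (rodr l (l + (m + 1) + 1)).eval (cos s) = q1 at *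
    simp only [show l + (m + 1) + 2 = l + (m + 1) + 1 + 1 from rfl] at ho
    generalize (rodr l (l + (m + 1) + 1 + 1)).eval (cos s) = q2 at *
    simp only [pow_add, pow_mul, mul_add] at *
    generalize (sin s ^ 2) ^ m = T at *
    have e2 : cos s ^ 2 = 1 - sin s ^ 2 := by linarith
    have e3 : cos s ^ 3 = cos s * (1 - sin s ^ 2) := by rw [← e2]; ring
    have e4 : cos s ^ 4 = (1 - sin s ^ 2) ^ 2 := by rw [← e2]; ring
    have ho' : sin s ^ 2 * q2 = 2 * ((m : ℝ) + 1 + 1) * cos s * q1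
        + ((l : ℝ) + (m + 1) + 1) * (m + 1 - l) * q := by
      linear_combination q2 * hs - ho
    linear_combination (norm := skip) (T * (4 * sin s ^ 3 * cos s * ((m + 3 / 2) * cos s * q - sin s ^ 2 * q1) - 2 * (1 - 2 * sin s ^ 2) * sin s ^ 3 * q)) * ho'
    ring_nf
    simp only [e2, e3, e4]
    ring
  have hc0 := continuous_rodr l (l + (m + 1))
  have hc1 := continuous_rodr l (l + (m + 1) + 1)
  have hI := intervalIntegral.integral_eq_sub_of_hasDerivAt (a := 0) (b := π) (fun s _ => hd s)
    (Continuous.intervalIntegrable (by fun_prop) _ _)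
  rw [intervalIntegral.integral_sub (Continuous.intervalIntegrable (by fun_prop) _ _)
    (Continuous.intervalIntegrable (by fun_prop) _ _), intervalIntegral.integral_const_mul,
    intervalIntegral.integral_const_mul] at hI
  simp only [sin_pi, sin_zero, zero_pow (Nat.succ_ne_zero (2 * m)), zero_mul, sub_zero] at hI
  unfold nrm
  linarith


lemma integrand_eq (m N : ℕ) (ν μ s : ℝ) (hs : s ∈ Ioo 0 π) :
    deltaV (m + 1) ν μ s * (pageY (m + 1 + N) (m + 1) s) ^ 2 =
    ν ^ 2 / 4 * ((1 + 2 * ((m + 1 + N : ℕ) : ℝ)) * (Nat.factorial N : ℝ) /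
      (2 * (Nat.factorial (m + 1 + N + (m + 1)) : ℝ)) *
      (1 / ((2 : ℝ) ^ (m + 1 + N) * (Nat.factorial (m + 1 + N) : ℝ))) ^ 2) *
    ((2 * μ + 4 * ((m : ℝ) + 1) ^ 2 + 1) * (sin s ^ (2 * (m + 1) + 1) *
        (rodr (m + 1 + N) (m + 1 + N + (m + 1))).eval (cos s) ^ 2)
      - μ * (sin s ^ (2 * m + 5) * (rodr (m + 1 + N) (m + 1 + N + (m + 1))).eval (cos s) ^ 2)
      + (4 * ((m : ℝ) + 1) ^ 2 - 1) * (sin s ^ (2 * m) * (s * cos s - sin s) *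
        (rodr (m + 1 + N) (m + 1 + N + (m + 1))).eval (cos s) ^ 2)) := by
  have hS : 0 < sin s := Real.sin_pos_of_mem_Ioo hs
  have hp : ((1 - cos s ^ 2) ^ (((m + 1 : ℕ) : ℝ) / 2)) = sin s ^ (m + 1) := by
    rw [show 1 - cos s ^ 2 = sin s ^ (2 : ℝ) by
      rw [Real.rpow_two]; linarith [Real.sin_sq_add_cos_sq s], ← Real.rpow_mul hS.le,
      mul_div_cancel₀ _ (two_ne_zero), Real.rpow_natCast]
  have hc2 : cos (2 * s) = 1 - 2 * sin s ^ 2 := by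
    rw [Real.cos_two_mul, Real.cos_sq']; ring
  have hc4 : cos (4 * s) = 2 * (1 - 2 * sin s ^ 2) ^ 2 - 1 := by
    rw [show 4 * s = 2 * (2 * s) by ring, Real.cos_two_mul, hc2]
  rw [pageY, deltaV, assocLegendreP, iteratedDeriv_legendreP, hp, hc2, hc4, mul_pow, mul_pow,
    Real.sq_sqrt (by positivity), Real.sq_sqrt hS.le, show m + 1 + N - (m + 1) = N by omega]
  generalize (1 + 2 * ((m + 1 + N : ℕ) : ℝ)) * (Nat.factorial N : ℝ) /
      (2 * (Nat.factorial (m + 1 + N + (m + 1)) : ℝ)) = c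
  generalize 1 / ((2 : ℝ) ^ (m + 1 + N) * (Nat.factorial (m + 1 + N) : ℝ)) = d
  generalize (rodr (m + 1 + N) (m + 1 + N + (m + 1))).eval (cos s) = q
  push_cast
  rw [show (sin s ^ (m + 1) * (d * q)) ^ 2 = sin s ^ (2 * m) * sin s ^ 2 * d ^ 2 * q ^ 2 by ring,
    show sin s ^ (2 * (m + 1) + 1) = sin s ^ (2 * m) * sin s ^ 3 by ring,
    show sin s ^ (2 * m + 5) = sin s ^ (2 * m) * sin s ^ 5 by ring]
  generalize sin s ^ (2 * m) = T
  field_simp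
  ring

/-- First-order perturbative correction to the spectrum of the Laplacian on the Page metric:
for integers `n ≥ 1`, `k ≥ 0`, `N ≥ 0`, with `μ = (2k+n)(2k+n+2) − n²` and `ℓ = n + N`,
the integral `∫₀^π δV(s) y_{ℓ,n}(s)² ds` converges and equals the quoted closed form. -/
theorem integral_deltaV_pageY (n k N : ℕ) (hn : 1 ≤ n) (ν : ℝ)
    (μ : ℝ) (hμ : μ = (2 * (k : ℝ) + n) * (2 * (k : ℝ) + n + 2) - (n : ℝ) ^ 2) :
    IntervalIntegrable (fun s => deltaV n ν μ s * (pageY (n + N) n s) ^ 2)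
      MeasureTheory.volume 0 π ∧
    (∫ s in (0 : ℝ)..π, deltaV n ν μ s * (pageY (n + N) n s) ^ 2) =
      -ν ^ 2 / ((2 * (n : ℝ) + 2 * (N : ℝ) - 1) * (2 * (n : ℝ) + 2 * (N : ℝ) + 3)) *
        (4 * (N : ℝ) ^ 4 + (16 * (n : ℝ) + 8) * (N : ℝ) ^ 3 +
          (-6 * (k : ℝ) ^ 2 - 6 * (k : ℝ) * ((n : ℝ) + 1) + 20 * (n : ℝ) ^ 2 +
              21 * (n : ℝ) + 1) * (N : ℝ) ^ 2 +
          (2 * (n : ℝ) + 1) *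
            (-6 * (k : ℝ) ^ 2 - 6 * (k : ℝ) * ((n : ℝ) + 1) + 4 * (n : ℝ) ^ 2 +
              5 * (n : ℝ) - 3) * (N : ℝ) -
          (2 * (n : ℝ) - 1) *
            (2 * (k : ℝ) ^ 2 * ((n : ℝ) + 2) +
              2 * (k : ℝ) * ((n : ℝ) ^ 2 + 3 * (n : ℝ) + 2) - (n : ℝ) * ((n : ℝ) + 1))) := by
  obtain ⟨m, rfl⟩ : ∃ m, n = m + 1 := ⟨n - 1, by omega⟩
  have hc0 := continuous_rodr (m + 1 + N) (m + 1 + N + (m + 1))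
  constructor
  · refine IntervalIntegrable.congr_ae (Continuous.intervalIntegrable (μ := MeasureTheory.volume)
      (u := fun s : ℝ => ν ^ 2 / 4 * ((1 + 2 * ((m + 1 + N : ℕ) : ℝ)) * (Nat.factorial N : ℝ) /
      (2 * (Nat.factorial (m + 1 + N + (m + 1)) : ℝ)) *
      (1 / ((2 : ℝ) ^ (m + 1 + N) * (Nat.factorial (m + 1 + N) : ℝ))) ^ 2) *
    ((2 * μ + 4 * ((m : ℝ) + 1) ^ 2 + 1) * (sin s ^ (2 * (m + 1) + 1) *
        (rodr (m + 1 + N) (m + 1 + N + (m + 1))).eval (cos s) ^ 2)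
      - μ * (sin s ^ (2 * m + 5) * (rodr (m + 1 + N) (m + 1 + N + (m + 1))).eval (cos s) ^ 2)
      + (4 * ((m : ℝ) + 1) ^ 2 - 1) * (sin s ^ (2 * m) * (s * cos s - sin s) *
        (rodr (m + 1 + N) (m + 1 + N + (m + 1))).eval (cos s) ^ 2))) (by fun_prop) 0 π) ?_
    rw [Filter.EventuallyEq, MeasureTheory.ae_restrict_iff' (by measurability)]
    filter_upwards [MeasureTheory.volume.ae_ne π] with s hs1 hs2
    rw [uIoc_of_le Real.pi_pos.le] at hs2
    exact (integrand_eq m N ν μ s ⟨hs2.1, lt_of_le_of_ne hs2.2 hs1⟩).symm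
  · rw [intervalIntegral.integral_congr_Ioo_of_le Real.pi_pos.le
      (fun s hs => integrand_eq m N ν μ s hs)]
    rw [intervalIntegral.integral_const_mul,
      intervalIntegral.integral_add (Continuous.intervalIntegrable (by fun_prop) _ _)
        (Continuous.intervalIntegrable (by fun_prop) _ _),
      intervalIntegral.integral_sub (Continuous.intervalIntegrable (by fun_prop) _ _)
        (Continuous.intervalIntegrable (by fun_prop) _ _),
      intervalIntegral.integral_const_mul, intervalIntegral.integral_const_mul,
      intervalIntegral.integral_const_mul, virial_s]
    have h2 := virial_sc (m + 1 + N) m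
    have hn := nrm_eq N (m + 1)
    have h0 : (∫ s in (0 : ℝ)..π, sin s ^ (2 * (m + 1) + 1) *
        (rodr (m + 1 + N) (m + 1 + N + (m + 1))).eval (cos s) ^ 2) = nrm (m + 1 + N) (m + 1) := rfl
    rw [h0]
    generalize (∫ s in (0 : ℝ)..π, sin s ^ (2 * m + 5) *
        (rodr (m + 1 + N) (m + 1 + N + (m + 1))).eval (cos s) ^ 2) = J at *
    have hpos := nrm_pos (m + 1) N
    generalize nrm (m + 1 + N) (m + 1) = I at *
    have hK : (1 + 2 * ((m + 1 + N : ℕ) : ℝ)) * (Nat.factorial N : ℝ) /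
      (2 * (Nat.factorial (m + 1 + N + (m + 1)) : ℝ)) *
      (1 / ((2 : ℝ) ^ (m + 1 + N) * (Nat.factorial (m + 1 + N) : ℝ))) ^ 2 = 1 / I := by
      have f1 : (0 : ℝ) < 2 * (Nat.factorial (m + 1 + N + (m + 1)) : ℝ) := by positivity
      have f2 : (0 : ℝ) < (2 : ℝ) ^ (m + 1 + N) * (Nat.factorial (m + 1 + N) : ℝ) := by positivity
      generalize 2 * (Nat.factorial (m + 1 + N + (m + 1)) : ℝ) = a at *
      generalize (2 : ℝ) ^ (m + 1 + N) * (Nat.factorial (m + 1 + N) : ℝ) = b at *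
      field_simp
      linear_combination hn
    rw [hK, hμ]
    push_cast at h2 ⊢
    rw [show (2 * ((m : ℝ) + 1) + 2 * (N : ℝ) - 1) = 2 * m + 2 * N + 1 by ring]
    have d1 : (2 * (m : ℝ) + 2 * N + 1) ≠ 0 := by positivity
    have d2 : (2 * ((m : ℝ) + 1) + 2 * (N : ℝ) + 3) ≠ 0 := by positivity
    have hJ : J = I * (1 / 2 + 2 * (((m : ℝ) + 1) ^ 2 - 1 / 4) /
        ((2 * (m : ℝ) + 2 * N + 1) * (2 * ((m : ℝ) + 1) + 2 * (N : ℝ) + 3))) := by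
      field_simp
      linear_combination -16 * h2
    rw [hJ]
    have hI := hpos.ne'
    field_simp
    ring
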